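/- There exist finite connected simple graphs G and G′, each with 8 vertices and 11 edges (hence of genus g = |E| − |V| + 1 = 4), such that T_G = T_{G′} as polynomials, G and G′ have the same two-variable zeta function (for every pair of integers (d, r), the number of divisor classes of degree d and Baker–Norine rank r on G equals that number on G′), and Jac(G) ≅ ℤ/5ℤ × ℤ/25ℤ while Jac(G′) ≅ ℤ/125ℤ; in particular Jac(G) and Jac(G′) are not isomorphic. -/

import Mathlib

open scoped Classical

namespace BNGraph

variable {V : Type} [Fintype V]

/-- The degree of a divisor `D : V → ℤ`: the sum of its values. -/
def degSum (D : V → ℤ) : ℤ := ∑ v, D v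

/-- A divisor is effective if all its values are nonnegative. -/
def Effective (D : V → ℤ) : Prop := ∀ v, 0 ≤ D v

/-- The combinatorial Laplacian of a graph, as a homomorphism on divisors. -/
noncomputable def lap (G : SimpleGraph V) : (V → ℤ) →+ (V → ℤ) where
  toFun f := fun v => (G.degree v : ℤ) * f v - ∑ w ∈ G.neighborFinset v, f w
  map_zero' := by
    funext v; simp
  map_add' f g := by
    funext v
    simp only [Pi.add_apply, Finset.sum_add_distrib]
    ring

/-- The subgroup of principal divisors: the image of the Laplacian. -/
noncomputable def Principal (G : SimpleGraph V) : AddSubgroup (V → ℤ) := (lap G).range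

/-- Linear equivalence of divisors. -/
def LinEquiv (G : SimpleGraph V) (D D' : V → ℤ) : Prop := D - D' ∈ Principal G

/-- A divisor is winnable if it is linearly equivalent to an effective divisor. -/
def Winnable (G : SimpleGraph V) (D : V → ℤ) : Prop :=
  ∃ E : V → ℤ, Effective E ∧ LinEquiv G D E

/-- The Baker–Norine rank of a divisor: the largest `r ≥ 0` such that `D - E` is
winnable for every effective divisor `E` of degree `r`, or `-1` if there is no such `r`
(equivalently, if `D` itself is not winnable). -/
noncomputable def bnRank (G : SimpleGraph V) (D : V → ℤ) : ℤ :=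
  sSup {r : ℤ | r = -1 ∨ (0 ≤ r ∧
    ∀ E : V → ℤ, Effective E → degSum E = r → Winnable G (D - E))}

/-- The Picard group of a graph: divisors modulo principal divisors. -/
abbrev Pic (G : SimpleGraph V) : Type _ := (V → ℤ) ⧸ Principal G

/-- The number of divisor classes of degree `d` and Baker–Norine rank `r`. -/
noncomputable def numClasses (G : SimpleGraph V) (d r : ℤ) : ℕ :=
  Set.ncard {c : Pic G | ∃ D : V → ℤ,
    QuotientAddGroup.mk' (Principal G) D = c ∧ degSum D = d ∧ bnRank G D = r}

/-- Two graphs have the same two-variable zeta function iff for every degree `d` and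
rank `r` they have the same number of divisor classes of degree `d` and rank `r`. -/
def SameZeta {W : Type} [Fintype W] (G : SimpleGraph V) (G' : SimpleGraph W) : Prop :=
  ∀ d r : ℤ, numClasses G d r = numClasses G' d r

/-- Degree as a homomorphism on divisors. -/
def degHom : (V → ℤ) →+ ℤ where
  toFun := degSum
  map_zero' := by simp [degSum]
  map_add' f g := by simp [degSum, Finset.sum_add_distrib]

/-- The subgroup of divisors of degree zero. -/
def Deg0 (V : Type) [Fintype V] : AddSubgroup (V → ℤ) := (degHom (V := V)).ker

/-- The Jacobian of a graph: divisor classes of degree zero. -/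
noncomputable abbrev Jac (G : SimpleGraph V) : Type _ :=
  Deg0 V ⧸ ((Principal G).addSubgroupOf (Deg0 V))

/-- The number of connected components of the spanning subgraph with edge set `A`. -/
noncomputable def numComponents (V : Type) [Fintype V] (A : Set (Sym2 V)) : ℕ :=
  Nat.card (SimpleGraph.fromEdgeSet A).ConnectedComponent

/-- The number of edges of a graph. -/
noncomputable def edgeCount (G : SimpleGraph V) : ℕ := Nat.card G.edgeSet

open MvPolynomial in
/-- The Tutte polynomial of `G`, as a polynomial in `ℤ[x, y]` with `x = X 0`, `y = X 1`:
`T_G(x,y) = Σ_{A ⊆ E(G)} (x−1)^(c(A)−c(E(G))) (y−1)^(c(A)+|A|−|V(G)|)`. -/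
noncomputable def tutte (G : SimpleGraph V) : MvPolynomial (Fin 2) ℤ :=
  ∑ A ∈ G.edgeFinset.powerset,
    (X 0 - 1) ^ (numComponents V ↑A - numComponents V G.edgeSet) *
    (X 1 - 1) ^ (numComponents V ↑A + A.card - Fintype.card V)


/-! ### Generic theory: reduction of ranks to a finite group -/

section Generic

set_option linter.unusedSectionVars false

variable {J : Type} [AddCommGroup J]

/-- The homomorphism on divisors determined by the images of the vertices. -/
def phi (p : V → J) : (V → ℤ) →+ J where
  toFun D := ∑ v, D v • p v
  map_zero' := by simp
  map_add' f g := by simp [add_smul, Finset.sum_add_distrib]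

lemma phi_apply (p : V → J) (D : V → ℤ) : phi p D = ∑ v, D v • p v := rfl

lemma phi_single (p : V → J) (v : V) (n : ℤ) : phi p (Pi.single v n) = n • p v := by
  rw [phi_apply, Finset.sum_eq_single v]
  · simp
  · intro w _ h; simp [Pi.single_eq_of_ne h]
  · simp

lemma degSum_single (v : V) (n : ℤ) : degSum (Pi.single v n) = n := by
  simp [degSum]

lemma degSum_add (D E : V → ℤ) : degSum (D + E) = degSum D + degSum E := by
  simp [degSum, Finset.sum_add_distrib]

lemma degSum_sub (D E : V → ℤ) : degSum (D - E) = degSum D - degSum E := by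
  simp [degSum, Finset.sum_sub_distrib]

lemma effective_deg {E : V → ℤ} (h : Effective E) : 0 ≤ degSum E :=
  Finset.sum_nonneg fun v _ => h v

lemma effective_zero_of_deg {E : V → ℤ} (h : Effective E) (h0 : degSum E = 0) : E = 0 := by
  funext v
  exact (Finset.sum_eq_zero_iff_of_nonneg (fun v _ => h v)).1 h0 v (Finset.mem_univ v)

lemma effective_succ {E : V → ℤ} {n : ℕ} (h : Effective E) (h0 : degSum E = (n : ℤ) + 1) :
    ∃ v, Effective (E - Pi.single v 1) := by
  by_contra hcon
  have hz : ∀ v, E v = 0 := by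
    intro v
    by_contra hv
    refine hcon ⟨v, fun w => ?_⟩
    by_cases hw : w = v
    · subst hw
      have := h w
      simp
      omega
    · simpa [Pi.single_eq_of_ne hw] using h w
  have : degSum E = 0 := by simp [degSum, hz]
  omega

lemma effective_add_single {E : V → ℤ} (h : Effective E) (v : V) :
    Effective (E + Pi.single v 1) := by
  intro w
  by_cases hw : w = v
  · subst hw
    have := h w
    simp
    omega
  · simpa [Pi.single_eq_of_ne hw] using h w

/-- Classes represented by effective divisors of degree `n`. -/
def effC (p : V → J) : ℕ → J → Prop
  | 0, j => j = 0
  | n + 1, j => ∃ v, effC p n (j - p v)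

lemma effC_iff (p : V → J) (n : ℕ) (j : J) :
    effC p n j ↔ ∃ E : V → ℤ, Effective E ∧ degSum E = n ∧ phi p E = j := by
  induction n generalizing j with
  | zero =>
    constructor
    · rintro rfl
      exact ⟨0, fun v => le_refl _, by simp [degSum], map_zero _⟩
    · rintro ⟨E, h1, h2, rfl⟩
      rw [effective_zero_of_deg h1 (by simpa using h2)]
      exact map_zero _
  | succ n ih =>
    constructor
    · rintro ⟨v, hv⟩
      obtain ⟨E, h1, h2, h3⟩ := (ih _).1 hv
      refine ⟨E + Pi.single v 1, effective_add_single h1 v, ?_, ?_⟩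
      · rw [degSum_add, degSum_single, h2]; push_cast; rfl
      · rw [map_add, phi_single, h3]; simp
    · rintro ⟨E, h1, h2, rfl⟩
      obtain ⟨v, hv⟩ := effective_succ (n := n) h1 (by rw [h2]; push_cast; rfl)
      refine ⟨v, (ih _).2 ⟨E - Pi.single v 1, hv, ?_, ?_⟩⟩
      · rw [degSum_sub, degSum_single, h2]; push_cast; ring
      · rw [map_sub, phi_single]; simp

/-- Classes that stay in `effC b` after subtracting any effective divisor of degree `r`. -/
def rkC (p : V → J) (b : ℕ) : ℕ → J → Prop
  | 0, j => effC p b j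
  | r + 1, j => ∀ v, rkC p b r (j - p v)

lemma rkC_iff (p : V → J) (b r : ℕ) (j : J) :
    rkC p b r j ↔ ∀ E : V → ℤ, Effective E → degSum E = r → effC p b (j - phi p E) := by
  induction r generalizing j with
  | zero =>
    constructor
    · intro h E h1 h2
      rw [effective_zero_of_deg h1 (by simpa using h2), map_zero, sub_zero]
      exact h
    · intro h
      have := h 0 (fun v => le_refl _) (by simp [degSum])
      rwa [map_zero, sub_zero] at this
  | succ r ih =>
    constructor
    · intro h E h1 h2
      obtain ⟨v, hv⟩ := effective_succ (n := r) h1 (by rw [h2]; push_cast; rfl)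
      have := (ih _).1 (h v) _ hv (by rw [degSum_sub, degSum_single, h2]; push_cast; ring)
      rw [map_sub, phi_single] at this
      simpa using this
    · intro h v
      refine (ih _).2 fun E h1 h2 => ?_
      have := h (E + Pi.single v 1) (effective_add_single h1 v)
        (by rw [degSum_add, degSum_single, h2]; push_cast; rfl)
      rw [map_add, phi_single] at this
      convert this using 1
      rw [one_smul]; abel

/-- `J` with the vertex images `p` describes the Picard group of `G`. -/
structure PicData (G : SimpleGraph V) (p : V → J) : Prop where
  ker : ∀ D, D ∈ Principal G ↔ degSum D = 0 ∧ phi p D = 0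
  surj : ∀ j, ∃ D, degSum D = 0 ∧ phi p D = j

variable {G : SimpleGraph V} {p : V → J}

lemma PicData.winnable_iff (h : PicData G p) (D : V → ℤ) (n : ℕ) (hn : degSum D = n) :
    Winnable G D ↔ effC p n (phi p D) := by
  rw [effC_iff]
  constructor
  · rintro ⟨E, h1, h2⟩
    have := (h.ker _).1 h2
    rw [degSum_sub, map_sub] at this
    exact ⟨E, h1, by omega, (sub_eq_zero.1 this.2).symm⟩
  · rintro ⟨E, h1, h2, h3⟩
    refine ⟨E, h1, (h.ker _).2 ?_⟩
    rw [degSum_sub, map_sub, h3, sub_self, h2, hn, sub_self]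
    exact ⟨rfl, rfl⟩

lemma PicData.deg_of_winnable (h : PicData G p) {D : V → ℤ} (hw : Winnable G D) :
    0 ≤ degSum D := by
  obtain ⟨E, h1, h2⟩ := hw
  have := (h.ker _).1 h2
  rw [degSum_sub] at this
  have := effective_deg h1
  omega

/-- A class of degree `d` has rank at least `r`. -/
def rkGe (p : V → J) (d : ℤ) (r : ℕ) (j : J) : Prop :=
  ∃ b : ℕ, d = r + b ∧ rkC p b r j

lemma PicData.rkGe_iff [Nonempty V] (h : PicData G p) (D : V → ℤ) (r : ℕ) :
    rkGe p (degSum D) r (phi p D) ↔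
      ∀ E : V → ℤ, Effective E → degSum E = r → Winnable G (D - E) := by
  constructor
  · rintro ⟨b, hb, hr⟩ E h1 h2
    rw [h.winnable_iff _ b (by rw [degSum_sub]; omega), map_sub]
    exact (rkC_iff _ _ _ _).1 hr E h1 h2
  · intro hE
    obtain ⟨v⟩ := ‹Nonempty V›
    have h1 : Effective (Pi.single v (r : ℤ) : V → ℤ) := by
      intro w
      by_cases hw : w = v
      · subst hw; simp
      · simp [Pi.single_eq_of_ne hw]
    have h2 := h.deg_of_winnable (hE _ h1 (degSum_single _ _))
    rw [degSum_sub, degSum_single] at h2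
    obtain ⟨b, hb⟩ := Int.eq_ofNat_of_zero_le h2
    refine ⟨b, by omega, (rkC_iff _ _ _ _).2 fun E e1 e2 => ?_⟩
    have := (h.winnable_iff _ b (by rw [degSum_sub]; omega)).1 (hE E e1 e2)
    rwa [map_sub] at this

lemma effC_succ (p : V → J) (v : V) (n : ℕ) (j : J) (h : effC p n (j - p v)) :
    effC p (n + 1) j := ⟨v, h⟩

lemma rkC_step [Nonempty V] (p : V → J) (b r : ℕ) (j : J) (h : rkC p b (r + 1) j) :
    rkC p (b + 1) r j := by
  induction r generalizing j with
  | zero => obtain ⟨v⟩ := ‹Nonempty V›; exact ⟨v, h v⟩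
  | succ r ih => exact fun v => ih _ (h v)

lemma rkGe_anti [Nonempty V] (p : V → J) (d : ℤ) (r : ℕ) (j : J) (h : rkGe p d (r + 1) j) :
    rkGe p d r j := by
  obtain ⟨b, hb, hr⟩ := h
  exact ⟨b + 1, by push_cast at *; omega, rkC_step _ _ _ _ hr⟩

lemma rkGe_anti' [Nonempty V] (p : V → J) (d : ℤ) {r s : ℕ} (hrs : r ≤ s) (j : J)
    (h : rkGe p d s j) : rkGe p d r j := by
  induction hrs with
  | refl => exact h
  | step _ ih => exact ih (rkGe_anti _ _ _ _ h)

/-- The set defining the rank. -/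
lemma PicData.rank_spec [Nonempty V] (h : PicData G p) (D : V → ℤ) :
    IsGreatest {r : ℤ | r = -1 ∨ (0 ≤ r ∧
      ∀ E : V → ℤ, Effective E → degSum E = r → Winnable G (D - E))} (bnRank G D) := by
  have hne : {r : ℤ | r = -1 ∨ (0 ≤ r ∧
      ∀ E : V → ℤ, Effective E → degSum E = r → Winnable G (D - E))}.Nonempty :=
    ⟨-1, Or.inl rfl⟩
  have hb : BddAbove {r : ℤ | r = -1 ∨ (0 ≤ r ∧
      ∀ E : V → ℤ, Effective E → degSum E = r → Winnable G (D - E))} := by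
    refine ⟨max (-1) (degSum D), ?_⟩
    rintro r (rfl | ⟨h0, hr⟩)
    · exact le_max_left _ _
    · refine le_max_of_le_right ?_
      obtain ⟨n, rfl⟩ := Int.eq_ofNat_of_zero_le h0
      obtain ⟨b, hb, _⟩ := (h.rkGe_iff D n).2 hr
      omega
  exact ⟨Int.csSup_mem hne hb, fun r hr => le_csSup hb hr⟩

lemma PicData.le_rank_iff [Nonempty V] (h : PicData G p) (D : V → ℤ) (r : ℕ) :
    (r : ℤ) ≤ bnRank G D ↔ rkGe p (degSum D) r (phi p D) := by
  obtain ⟨h1, h2⟩ := h.rank_spec D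
  constructor
  · intro hle
    rcases h1 with h1 | ⟨h0, h1⟩
    · omega
    · obtain ⟨n, hn⟩ := Int.eq_ofNat_of_zero_le h0
      rw [hn] at h1 hle
      exact rkGe_anti' _ _ (by omega) _ ((h.rkGe_iff D n).2 h1)
  · intro hr
    exact h2 (Or.inr ⟨by omega, (h.rkGe_iff D r).1 hr⟩)

lemma PicData.neg_one_le_rank [Nonempty V] (h : PicData G p) (D : V → ℤ) :
    -1 ≤ bnRank G D := (h.rank_spec D).2 (Or.inl rfl)

lemma PicData.exists_deg [Nonempty V] (h : PicData G p) (d : ℤ) (j : J) :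
    ∃ D : V → ℤ, degSum D = d ∧ phi p D = j := by
  obtain ⟨v⟩ := ‹Nonempty V›
  obtain ⟨D, h1, h2⟩ := h.surj (j - d • p v)
  refine ⟨D + Pi.single v d, ?_, ?_⟩
  · rw [degSum_add, h1, degSum_single, zero_add]
  · rw [map_add, h2, phi_single]; abel

lemma PicData.numClasses_eq [Nonempty V] (h : PicData G p) (d r : ℤ) (T : Set J)
    (hT : ∀ D : V → ℤ, degSum D = d → (bnRank G D = r ↔ phi p D ∈ T)) :
    numClasses G d r = T.ncard := by
  choose s hs1 hs2 using h.exists_deg d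
  have hmk : ∀ D D' : V → ℤ, QuotientAddGroup.mk' (Principal G) D =
      QuotientAddGroup.mk' (Principal G) D' ↔ degSum D = degSum D' ∧ phi p D = phi p D' := by
    intro D D'
    have h2 := h.ker (-D + D')
    rw [QuotientAddGroup.mk'_apply, QuotientAddGroup.mk'_apply, QuotientAddGroup.eq, h2,
      neg_add_eq_sub, degSum_sub, map_sub, sub_eq_zero, sub_eq_zero]
    exact ⟨fun ⟨a, b⟩ => ⟨a.symm, b.symm⟩, fun ⟨a, b⟩ => ⟨a.symm, b.symm⟩⟩
  have hinj : Function.Injective (fun j => QuotientAddGroup.mk' (Principal G) (s j)) := by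
    intro j j' hj
    have := ((hmk _ _).1 hj).2
    rwa [hs2, hs2] at this
  rw [numClasses, ← Set.ncard_image_of_injective T hinj]
  congr 1
  ext c
  constructor
  · rintro ⟨D, rfl, h1, h2⟩
    refine ⟨phi p D, (hT D h1).1 h2, (hmk _ _).2 ?_⟩
    rw [hs1, hs2, h1]
    exact ⟨rfl, rfl⟩
  · rintro ⟨j, hj, rfl⟩
    refine ⟨s j, rfl, hs1 j, (hT _ (hs1 j)).2 ?_⟩
    rwa [hs2]

lemma PicData.numClasses_lt [Nonempty V] (h : PicData G p) (d r : ℤ) (hr : r < -1) :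
    numClasses G d r = 0 := by
  rw [h.numClasses_eq d r ∅, Set.ncard_empty]
  intro D _
  have := h.neg_one_le_rank D
  simp
  omega

lemma PicData.numClasses_neg_one [Nonempty V] [Finite J] (h : PicData G p) (d : ℤ) :
    numClasses G d (-1) = Nat.card J - {j | rkGe p d 0 j}.ncard := by
  rw [h.numClasses_eq d (-1) {j | rkGe p d 0 j}ᶜ, Set.ncard_compl]
  rintro D rfl
  have h1 := h.neg_one_le_rank D
  have h2 := h.le_rank_iff D 0
  rw [Set.mem_compl_iff, Set.mem_ofPred_eq, ← h2]
  push_cast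
  omega

lemma PicData.numClasses_nat [Nonempty V] [Finite J] (h : PicData G p) (d : ℤ) (r : ℕ) :
    numClasses G d r = {j | rkGe p d r j}.ncard - {j | rkGe p d (r + 1) j}.ncard := by
  rw [h.numClasses_eq d r ({j | rkGe p d r j} \ {j | rkGe p d (r + 1) j}), Set.ncard_sdiff]
  · exact fun j hj => rkGe_anti _ _ _ _ hj
  · rintro D rfl
    have h1 := h.le_rank_iff D r
    have h2 := h.le_rank_iff D (r + 1)
    rw [Set.mem_sdiff, Set.mem_ofPred_eq, Set.mem_ofPred_eq, ← h1, ← h2]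
    push_cast
    omega

lemma sameZeta_of {W J' : Type} [Fintype W] [AddCommGroup J'] [Nonempty V] [Nonempty W]
    [Finite J] [Finite J'] {G' : SimpleGraph W} {p' : W → J'}
    (h : PicData G p) (h' : PicData G' p') (hc : Nat.card J = Nat.card J')
    (hr : ∀ b r, {j | rkC p b r j}.ncard = {j | rkC p' b r j}.ncard) : SameZeta G G' := by
  have key : ∀ (d : ℤ) (r : ℕ), {j | rkGe p d r j}.ncard = {j | rkGe p' d r j}.ncard := by
    intro d r
    by_cases hd : (r : ℤ) ≤ d
    · obtain ⟨b, hb⟩ := Int.eq_ofNat_of_zero_le (sub_nonneg.2 hd)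
      have e1 : {j | rkGe p d r j} = {j | rkC p b r j} := by
        ext j
        constructor
        · rintro ⟨b', h1, h2⟩
          obtain rfl : b' = b := by omega
          exact h2
        · exact fun hj => ⟨b, by omega, hj⟩
      have e2 : {j | rkGe p' d r j} = {j | rkC p' b r j} := by
        ext j
        constructor
        · rintro ⟨b', h1, h2⟩
          obtain rfl : b' = b := by omega
          exact h2
        · exact fun hj => ⟨b, by omega, hj⟩
      rw [e1, e2, hr]
    · have e1 : {j | rkGe p d r j} = ∅ := by
        ext j
        simp only [Set.mem_ofPred_eq, Set.mem_empty_iff_false, iff_false]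
        rintro ⟨b', h1, h2⟩
        omega
      have e2 : {j | rkGe p' d r j} = ∅ := by
        ext j
        simp only [Set.mem_ofPred_eq, Set.mem_empty_iff_false, iff_false]
        rintro ⟨b', h1, h2⟩
        omega
      rw [e1, e2, Set.ncard_empty, Set.ncard_empty]
  intro d r
  rcases lt_trichotomy r (-1) with hlt | rfl | hgt
  · rw [h.numClasses_lt d r hlt, h'.numClasses_lt d r hlt]
  · rw [h.numClasses_neg_one, h'.numClasses_neg_one, key, hc]
  · obtain ⟨n, rfl⟩ := Int.eq_ofNat_of_zero_le (show 0 ≤ r by omega)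
    rw [h.numClasses_nat, h'.numClasses_nat, key, key]

/-- Bit-mask certificate for the sets `rkC`. -/
structure MaskData (p : V → J) (code : J → ℕ) (M : ℕ → ℕ → ℕ) : Prop where
  zero : ∀ j, (M 0 0).testBit (code j) = true ↔ j = 0
  eff : ∀ b < 3, ∀ j, (M (b + 1) 0).testBit (code j) = true ↔
    ∃ v, (M b 0).testBit (code (j - p v)) = true
  eff4 : ∀ j, ∃ v, (M 3 0).testBit (code (j - p v)) = true
  rk : ∀ b < 4, ∀ r < 3, ∀ j, (M b (r + 1)).testBit (code j) = true ↔
    ∀ v, (M b r).testBit (code (j - p v)) = true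
  rk4 : ∀ b < 4, ∀ j, ¬ ∀ v, (M b 3).testBit (code (j - p v)) = true

variable {code : J → ℕ} {M : ℕ → ℕ → ℕ}

lemma MaskData.effC_eq (h : MaskData p code M) (b : ℕ) (hb : b < 4) (j : J) :
    effC p b j ↔ (M b 0).testBit (code j) = true := by
  induction b generalizing j with
  | zero => exact (h.zero j).symm
  | succ b ih =>
    rw [h.eff b (by omega) j]
    exact exists_congr fun v => ih (by omega) _

lemma MaskData.rkC_eq (h : MaskData p code M) (b : ℕ) (hb : b < 4) (r : ℕ) (hr : r < 4) (j : J) :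
    rkC p b r j ↔ (M b r).testBit (code j) = true := by
  induction r generalizing j with
  | zero => exact h.effC_eq b hb j
  | succ r ih =>
    rw [h.rk b hb r (by omega) j]
    exact forall_congr' fun v => ih (by omega) _

lemma MaskData.effC_ge [Nonempty V] (h : MaskData p code M) (b : ℕ) (hb : 4 ≤ b) (j : J) :
    effC p b j := by
  induction hb generalizing j with
  | refl =>
    obtain ⟨v, hv⟩ := h.eff4 j
    exact ⟨v, (h.effC_eq 3 (by omega) _).2 hv⟩
  | step _ ih => obtain ⟨v⟩ := ‹Nonempty V›; exact ⟨v, ih _⟩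

lemma MaskData.rkC_ge [Nonempty V] (h : MaskData p code M) (b : ℕ) (hb : 4 ≤ b) (r : ℕ) (j : J) :
    rkC p b r j := by
  induction r generalizing j with
  | zero => exact h.effC_ge b hb j
  | succ r ih => exact fun v => ih _

lemma MaskData.not_rkC [Nonempty V] (h : MaskData p code M) (b : ℕ) (hb : b < 4) (r : ℕ)
    (hr : 4 ≤ r) (j : J) : ¬ rkC p b r j := by
  induction hr generalizing j with
  | refl =>
    intro hj
    exact h.rk4 b hb j fun v => (h.rkC_eq b hb 3 (by omega) _).1 (hj v)
  | step _ ih => obtain ⟨v⟩ := ‹Nonempty V›; exact fun hj => ih _ (hj v)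

lemma mask_count {W J' : Type} [Fintype W] [AddCommGroup J'] [Nonempty V] [Nonempty W]
    [Fintype J] [Fintype J'] {p' : W → J'} {code' : J' → ℕ} {M' : ℕ → ℕ → ℕ}
    (h : MaskData p code M) (h' : MaskData p' code' M') (hc : Nat.card J = Nat.card J')
    (hcount : ∀ b < 4, ∀ r < 4,
      (Finset.univ.filter fun j => (M b r).testBit (code j) = true).card =
      (Finset.univ.filter fun j => (M' b r).testBit (code' j) = true).card) (b r : ℕ) :
    {j | rkC p b r j}.ncard = {j | rkC p' b r j}.ncard := by
  by_cases hb : b < 4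
  · by_cases hr : r < 4
    · simp only [h.rkC_eq b hb r hr, h'.rkC_eq b hb r hr]
      have := hcount b hb r hr
      rw [← Set.ncard_coe_finset, ← Set.ncard_coe_finset] at this
      simpa using this
    · have e1 := h.not_rkC b hb r (by omega)
      have e2 := h'.not_rkC b hb r (by omega)
      simp [e1, e2]
  · have e1 := h.rkC_ge b (by omega) r
    have e2 := h'.rkC_ge b (by omega) r
    simp only [e1, e2, Set.ofPred_true, Set.ncard_univ]
    exact hc

/-- The Jacobian described by Picard data. -/
lemma PicData.jac (h : PicData G p) : Nonempty (Jac G ≃+ J) := by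
  let f : Deg0 V →+ J := (phi p).comp (Deg0 V).subtype
  have hs : Function.Surjective f := by
    intro j
    obtain ⟨D, h1, h2⟩ := h.surj j
    exact ⟨⟨D, h1⟩, h2⟩
  have hk : (Principal G).addSubgroupOf (Deg0 V) = f.ker := by
    ext ⟨D, hD⟩
    rw [AddSubgroup.mem_addSubgroupOf, AddMonoidHom.mem_ker]
    exact (h.ker D).trans ⟨fun x => x.2, fun x => ⟨hD, x⟩⟩
  exact ⟨(QuotientAddGroup.quotientAddEquivOfEq hk).trans
    (QuotientAddGroup.quotientKerEquivOfSurjective f hs)⟩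

lemma lap_eq (G : SimpleGraph V) (f : V → ℤ) (v : V) :
    lap G f v = ∑ w, if G.Adj v w then f v - f w else 0 := by
  change (G.degree v : ℤ) * f v - ∑ w ∈ G.neighborFinset v, f w = _
  rw [← Finset.sum_filter, Finset.sum_sub_distrib]
  have : Finset.univ.filter (fun w => G.Adj v w) = G.neighborFinset v := by
    ext w; simp
  rw [this, Finset.sum_const, SimpleGraph.card_neighborFinset_eq_degree]
  simp

end Generic

/-! ### Tutte polynomials by edge-by-edge computation -/

section Tutte

/-- The label of a vertex in a list of labels. -/
def lab (l : List ℕ) (v : Fin 8) : ℕ := l.getD v.val 0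

/-- Identify the label of `b` with the label of `a`. -/
def mergeL (l : List ℕ) (a b : Fin 8) : List ℕ :=
  l.map fun z => if z = lab l b then lab l a else z

/-- The labels describe the components of the graph with edge set `A`. -/
structure Good (l : List ℕ) (A : Set (Sym2 (Fin 8))) : Prop where
  len : l.length = 8
  iff : ∀ u v, lab l u = lab l v ↔ (SimpleGraph.fromEdgeSet A).Reachable u v

lemma lab_mergeL {l : List ℕ} (hl : l.length = 8) (a b v : Fin 8) :
    lab (mergeL l a b) v = if lab l v = lab l b then lab l a else lab l v := by
  have h1 : v.val < l.length := by omega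
  simp [lab, mergeL, List.getD_eq_getElem?_getD, h1]

lemma Good.merge {l : List ℕ} {A : Set (Sym2 (Fin 8))} (h : Good l A) (a b : Fin 8) :
    Good (mergeL l a b) (insert s(a, b) A) := by
  refine ⟨by simp [mergeL, h.len], fun u v => ?_⟩
  have hmono : ∀ {x y}, lab l x = lab l y →
      (SimpleGraph.fromEdgeSet (insert s(a, b) A)).Reachable x y := fun hxy =>
    ((h.iff _ _).1 hxy).mono (SimpleGraph.fromEdgeSet_mono (Set.subset_insert _ _))
  have hab : (SimpleGraph.fromEdgeSet (insert s(a, b) A)).Reachable a b := by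
    by_cases hne : a = b
    · subst hne; exact SimpleGraph.Reachable.refl _
    · exact SimpleGraph.Adj.reachable (by simp [SimpleGraph.fromEdgeSet_adj, hne])
  constructor
  · rw [lab_mergeL h.len, lab_mergeL h.len]
    split_ifs with h1 h2 h2
    · exact fun _ => hmono (h1.trans h2.symm)
    · exact fun h3 => (hmono h1).trans (hab.symm.trans (hmono h3))
    · exact fun h3 => (hmono h3).trans (hab.trans (hmono h2.symm))
    · exact fun h3 => hmono h3
  · rintro ⟨w⟩
    induction w with
    | nil => rfl
    | cons hadj _ ih =>
      refine Eq.trans ?_ ih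
      rw [SimpleGraph.fromEdgeSet_adj, Set.mem_insert_iff] at hadj
      obtain ⟨h1 | h1, h2⟩ := hadj
      · rw [lab_mergeL h.len, lab_mergeL h.len]
        rw [Sym2.eq_iff] at h1
        rcases h1 with ⟨rfl, rfl⟩ | ⟨rfl, rfl⟩ <;> simp
      · have := (h.iff _ _).2 (SimpleGraph.Adj.reachable
          ((SimpleGraph.fromEdgeSet_adj A).2 ⟨h1, h2⟩))
        rw [lab_mergeL h.len, lab_mergeL h.len, this]

lemma Good.comp {l : List ℕ} {A : Set (Sym2 (Fin 8))} (h : Good l A) :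
    numComponents (Fin 8) A = (Set.range (lab l)).ncard := by
  let f : (SimpleGraph.fromEdgeSet A).ConnectedComponent → ℕ :=
    SimpleGraph.ConnectedComponent.lift (lab l) fun v w p _ => (h.iff v w).2 ⟨p⟩
  have hf : Function.Injective f := by
    intro x y
    induction x using SimpleGraph.ConnectedComponent.ind with | _ x =>
    induction y using SimpleGraph.ConnectedComponent.ind with | _ y =>
    intro hxy
    exact SimpleGraph.ConnectedComponent.sound ((h.iff x y).1 hxy)
  have hr : Set.range f = Set.range (lab l) := by
    ext n
    constructor
    · rintro ⟨x, rfl⟩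
      induction x using SimpleGraph.ConnectedComponent.ind with | _ x =>
      exact ⟨x, rfl⟩
    · rintro ⟨x, rfl⟩
      exact ⟨SimpleGraph.connectedComponentMk _ x, rfl⟩
  rw [numComponents, ← hr, ← Nat.card_coe_set_eq]
  exact Nat.card_congr (Equiv.ofInjective f hf)

lemma Good.comp_merge {l : List ℕ} {A : Set (Sym2 (Fin 8))} (h : Good l A) (a b : Fin 8) :
    numComponents (Fin 8) (insert s(a, b) A) =
      if lab l a = lab l b then numComponents (Fin 8) A else numComponents (Fin 8) A - 1 := by
  rw [(h.merge a b).comp, h.comp]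
  split_ifs with hab
  · congr 1
    have : lab (mergeL l a b) = lab l := by
      funext v
      rw [lab_mergeL h.len]
      split_ifs with h1
      · rw [h1, hab]
      · rfl
    rw [this]
  · have : Set.range (lab (mergeL l a b)) = Set.range (lab l) \ {lab l b} := by
      ext n
      constructor
      · rintro ⟨v, rfl⟩
        rw [lab_mergeL h.len]
        split_ifs with h1
        · exact ⟨⟨a, rfl⟩, hab⟩
        · exact ⟨⟨v, rfl⟩, h1⟩
      · rintro ⟨⟨v, rfl⟩, h1⟩
        exact ⟨v, by rw [lab_mergeL h.len]; exact if_neg h1⟩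
    rw [this, Set.ncard_sdiff_singleton_of_mem (Set.mem_range_self b)]

/-- Add an entry to a table of multiplicities. -/
def ins (k c : ℕ) : List (ℕ × ℕ) → List (ℕ × ℕ)
  | [] => [(k, c)]
  | (k', c') :: t =>
    if k < k' then (k, c) :: (k', c') :: t
    else if k = k' then (k', c + c') :: t
    else (k', c') :: ins k c t

/-- Sum of two tables of multiplicities. -/
def addT : List (ℕ × ℕ) → List (ℕ × ℕ) → List (ℕ × ℕ)
  | [], t => t
  | (k, c) :: s, t => ins k c (addT s t)

/-- The table of all pairs (number of components, number of edges), coded by `16 c + n`. -/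
def goT : List (Fin 8 × Fin 8) → List ℕ → ℕ → ℕ → List (ℕ × ℕ)
  | [], _, c, n => [(16 * c + n, 1)]
  | e :: es, l, c, n =>
    addT (goT es l c n)
      (if lab l e.1 = lab l e.2 then goT es l c (n + 1)
       else goT es (mergeL l e.1 e.2) (c - 1) (n + 1))

variable {M : Type} [AddCommMonoid M]

/-- Evaluate a table. -/
def evT (F : ℕ → M) (t : List (ℕ × ℕ)) : M := (t.map fun x => x.2 • F x.1).sum

lemma evT_ins (F : ℕ → M) (k c : ℕ) (t : List (ℕ × ℕ)) :
    evT F (ins k c t) = c • F k + evT F t := by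
  induction t with
  | nil => simp [ins, evT]
  | cons x t ih =>
    obtain ⟨k', c'⟩ := x
    rw [ins]
    split_ifs with h1 h2
    · simp [evT]
    · subst h2
      simp [evT, add_smul, add_assoc]
    · have e1 : ∀ t, evT F ((k', c') :: t) = c' • F k' + evT F t := fun t => by simp [evT]
      rw [e1, e1, ih]
      abel

lemma evT_addT (F : ℕ → M) (s t : List (ℕ × ℕ)) :
    evT F (addT s t) = evT F s + evT F t := by
  induction s with
  | nil => simp [addT, evT]
  | cons x s ih =>
    obtain ⟨k, c⟩ := x
    rw [addT, evT_ins, ih]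
    simp [evT, add_assoc]

/-- The edges of a list of pairs. -/
def toE (es : List (Fin 8 × Fin 8)) : List (Sym2 (Fin 8)) := es.map fun e => s(e.1, e.2)

lemma goT_spec (F : ℕ → M) (es : List (Fin 8 × Fin 8)) (hn : (toE es).Nodup)
    (l : List ℕ) (A : Finset (Sym2 (Fin 8))) (hA : ∀ e ∈ toE es, e ∉ A)
    (hg : Good l (A : Set (Sym2 (Fin 8)))) :
    ∑ B ∈ (toE es).toFinset.powerset,
      F (16 * numComponents (Fin 8) ((A ∪ B : Finset (Sym2 (Fin 8))) : Set (Sym2 (Fin 8)))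
        + (A ∪ B).card) =
    evT F (goT es l (numComponents (Fin 8) (A : Set (Sym2 (Fin 8)))) A.card) := by
  induction es generalizing l A with
  | nil => simp [toE, goT, evT]
  | cons e es ih =>
    have hn' : s(e.1, e.2) ∉ toE es ∧ (toE es).Nodup := by simpa [toE] using hn
    have hE : (toE (e :: es)).toFinset = insert s(e.1, e.2) (toE es).toFinset := by
      simp [toE]
    have heA : s(e.1, e.2) ∉ A := hA _ (by simp [toE])
    have hesA : ∀ x ∈ toE es, x ∉ A := fun x hx => hA x (by
      have : toE (e :: es) = s(e.1, e.2) :: toE es := rfl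
      rw [this]; exact List.mem_cons_of_mem _ hx)
    rw [hE, Finset.sum_powerset_insert (by simpa using hn'.1), goT, evT_addT,
      ih hn'.2 l A hesA hg]
    congr 1
    have hg2 : Good (mergeL l e.1 e.2)
        ((insert s(e.1, e.2) A : Finset (Sym2 (Fin 8))) : Set (Sym2 (Fin 8))) := by
      rw [Finset.coe_insert]; exact hg.merge _ _
    have hA2 : ∀ x ∈ toE es, x ∉ insert s(e.1, e.2) A := by
      intro x hx hx2
      rcases Finset.mem_insert.1 hx2 with rfl | h3
      · exact hn'.1 hx
      · exact hesA x hx h3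
    have hu : ∀ B, A ∪ insert s(e.1, e.2) B = insert s(e.1, e.2) A ∪ B := by
      intro B; rw [Finset.union_insert, Finset.insert_union]
    have hc := hg.comp_merge e.1 e.2
    simp only [hu]
    split_ifs with h1
    · rw [if_pos h1] at hc
      have hg3 : Good l
          ((insert s(e.1, e.2) A : Finset (Sym2 (Fin 8))) : Set (Sym2 (Fin 8))) := by
        refine ⟨hg.len, fun u v => ?_⟩
        rw [← hg2.iff, lab_mergeL hg.len, lab_mergeL hg.len]
        split_ifs with h2 h3 h3
        · simp [h2, h3]
        · rw [h2, h1]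
        · rw [h3, h1]
        · rfl
      rw [ih hn'.2 l _ hA2 hg3, Finset.coe_insert, hc, Finset.card_insert_of_notMem heA]
    · rw [if_neg h1] at hc
      rw [ih hn'.2 _ _ hA2 hg2, Finset.coe_insert, hc, Finset.card_insert_of_notMem heA]

/-- Initial labels. -/
def lab0 : List ℕ := [0, 1, 2, 3, 4, 5, 6, 7]

lemma lab0_val (v : Fin 8) : lab lab0 v = v.val := by
  fin_cases v <;> rfl

lemma good0 : Good lab0 ((∅ : Finset (Sym2 (Fin 8))) : Set (Sym2 (Fin 8))) := by
  refine ⟨rfl, fun u v => ?_⟩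
  rw [lab0_val, lab0_val, Finset.coe_empty, SimpleGraph.fromEdgeSet_empty,
    SimpleGraph.reachable_bot, Fin.ext_iff]

lemma comp0 : numComponents (Fin 8) ((∅ : Finset (Sym2 (Fin 8))) : Set (Sym2 (Fin 8))) = 8 := by
  rw [good0.comp]
  have : lab lab0 = Fin.val := funext lab0_val
  rw [this, ← Set.image_univ, Set.ncard_image_of_injective _ Fin.val_injective]
  simp

/-- The graph with a given list of edges. -/
def mkG (es : List (Fin 8 × Fin 8)) : SimpleGraph (Fin 8) :=
  SimpleGraph.fromEdgeSet {e | e ∈ toE es}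

/-- Final labels. -/
def labF (es : List (Fin 8 × Fin 8)) : List ℕ → List ℕ :=
  fun l => es.foldl (fun l e => mergeL l e.1 e.2) l

lemma good_labF (es : List (Fin 8 × Fin 8)) (l : List ℕ) (A : Set (Sym2 (Fin 8)))
    (h : Good l A) : Good (labF es l) (A ∪ {e | e ∈ toE es}) := by
  induction es generalizing l A with
  | nil => simpa [labF, toE] using h
  | cons e es ih =>
    have := ih _ _ (h.merge e.1 e.2)
    have h2 : insert s(e.1, e.2) A ∪ {x | x ∈ toE es} = A ∪ {x | x ∈ toE (e :: es)} := by
      ext x; simp [toE]; tauto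
    rw [h2] at this
    exact this

lemma mkG_connected (es : List (Fin 8 × Fin 8))
    (h : ∀ v, lab (labF es lab0) v = lab (labF es lab0) 0) : (mkG es).Connected := by
  have hg := good_labF es lab0 _ good0
  rw [Finset.coe_empty, Set.empty_union] at hg
  have : (mkG es).Preconnected := fun u v => (hg.iff u v).1 ((h u).trans (h v).symm)
  exact ⟨this⟩

lemma mkG_edgeSet (es : List (Fin 8 × Fin 8)) (h : ∀ e ∈ toE es, ¬ e.IsDiag) :
    (mkG es).edgeSet = ((toE es).toFinset : Set (Sym2 (Fin 8))) := by
  ext x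
  rw [mkG, SimpleGraph.edgeSet_fromEdgeSet]
  simp only [Set.mem_sdiff, Set.mem_ofPred_eq, Sym2.mem_diagSet, List.coe_toFinset]
  exact ⟨fun hx => hx.1, fun hx => ⟨hx, h x hx⟩⟩

lemma mkG_edgeCount (es : List (Fin 8 × Fin 8)) (h : ∀ e ∈ toE es, ¬ e.IsDiag)
    (hn : (toE es).Nodup) : edgeCount (mkG es) = es.length := by
  rw [edgeCount, mkG_edgeSet es h, Nat.card_coe_set_eq, Set.ncard_coe_finset,
    List.toFinset_card_of_nodup hn, toE, List.length_map]

lemma conn_comp (G : SimpleGraph (Fin 8)) (h : G.Connected) :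
    numComponents (Fin 8) G.edgeSet = 1 := by
  rw [numComponents, SimpleGraph.fromEdgeSet_edgeSet]
  have := h.preconnected.subsingleton_connectedComponent
  have : Nonempty G.ConnectedComponent := ⟨G.connectedComponentMk 0⟩
  exact Nat.card_unique

open MvPolynomial in
/-- The term of the Tutte polynomial with code `k = 16 c + n`. -/
noncomputable def tterm (k : ℕ) : MvPolynomial (Fin 2) ℤ :=
  (X 0 - 1) ^ (k / 16 - 1) * (X 1 - 1) ^ (k / 16 + k % 16 - 8)

lemma tutte_eq (es : List (Fin 8 × Fin 8)) (h : ∀ e ∈ toE es, ¬ e.IsDiag)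
    (hn : (toE es).Nodup) (hl : es.length < 16) (hc : (mkG es).Connected) :
    tutte (mkG es) = evT tterm (goT es lab0 8 0) := by
  have h1 := goT_spec tterm es hn lab0 ∅ (by simp) good0
  rw [comp0, Finset.card_empty] at h1
  rw [← h1, tutte, conn_comp _ hc]
  have hE : (mkG es).edgeFinset = (toE es).toFinset := by
    apply Finset.coe_injective
    rw [SimpleGraph.coe_edgeFinset, mkG_edgeSet es h]
  rw [hE]
  refine Finset.sum_congr rfl fun B hB => ?_
  have hB2 : B.card < 16 := by
    have := Finset.card_le_card (Finset.mem_powerset.1 hB)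
    rw [List.toFinset_card_of_nodup hn, toE, List.length_map] at this
    omega
  rw [Finset.empty_union, tterm]
  have e1 : (16 * numComponents (Fin 8) (B : Set (Sym2 (Fin 8))) + B.card) / 16
      = numComponents (Fin 8) (B : Set (Sym2 (Fin 8))) := by omega
  have e2 : (16 * numComponents (Fin 8) (B : Set (Sym2 (Fin 8))) + B.card) % 16
      = B.card := by omega
  rw [e1, e2, Fintype.card_fin]

end Tutte

/-! ### The two graphs -/

section Concrete

/-- Edges of the first graph. -/
def es1 : List (Fin 8 × Fin 8) :=
  [(0, 3), (0, 4), (0, 5), (1, 3), (1, 7), (2, 4), (2, 5), (3, 4), (3, 6), (4, 7), (5, 6)]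

/-- Edges of the second graph. -/
def es2 : List (Fin 8 × Fin 8) :=
  [(0, 1), (0, 3), (0, 6), (0, 7), (1, 4), (1, 5), (2, 4), (2, 6), (3, 4), (3, 5), (3, 7)]

lemma conn1 : (mkG es1).Connected := mkG_connected _ (by decide +kernel)
lemma conn2 : (mkG es2).Connected := mkG_connected _ (by decide +kernel)
lemma diag1 : ∀ e ∈ toE es1, ¬ e.IsDiag := by decide +kernel
lemma diag2 : ∀ e ∈ toE es2, ¬ e.IsDiag := by decide +kernel
lemma nodup1 : (toE es1).Nodup := by decide +kernel
lemma nodup2 : (toE es2).Nodup := by decide +kernel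

lemma tables_eq : goT es1 lab0 8 0 = goT es2 lab0 8 0 := by decide +kernel

/-- Images of the vertices of the first graph in its Jacobian. -/
def p1 : Fin 8 → ZMod 5 × ZMod 25 :=
  ![(4, 22), (0, 24), (1, 9), (0, 23), (0, 1), (2, 17), (1, 20), (0, 0)]

/-- Images of the vertices of the second graph in its Jacobian. -/
def p2 : Fin 8 → ZMod 125 := ![17, 19, 115, 108, 39, 1, 66, 0]

/-- Masks for the first graph. -/
def M1 (b r : ℕ) : ℕ :=
  ((([[1, 0, 0, 0], [5316911983139663639189216032374915075, 0, 0, 0],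
    [19939068993842914191771624228721393735, 2658455991569831819594590415398895616, 0, 0],
    [42226202792647138087056401638201723135, 9969534496921457095885785386772791356,
      1329227995784915909797296238491729928, 137438953472]] : List (List ℕ)).getD b []).getD r 0)

/-- Masks for the second graph. -/
def M2 (b r : ℕ) : ℕ :=
  ((([[1, 0, 0, 0], [41862893421937121542003971249012739, 0, 0, 0],
    [125629564522208068195310837966963335, 549756338176, 0, 0],
    [26877749641466198590728609626303895471, 249272403582934441248030784917078533,
      166153499473152558625092332056739840, 288230376151711744]] : List (List ℕ)).getD b []).getD r 0)

/-- Codes of elements of the first Jacobian. -/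
def code1 (j : ZMod 5 × ZMod 25) : ℕ := 25 * j.1.val + j.2.val

/-- Codes of elements of the second Jacobian. -/
def code2 (j : ZMod 125) : ℕ := j.val

lemma mask1 : MaskData p1 code1 M1 where
  zero := by decide +kernel
  eff := by decide +kernel
  eff4 := by decide +kernel
  rk := by decide +kernel
  rk4 := by decide +kernel

lemma mask2 : MaskData p2 code2 M2 where
  zero := by decide +kernel
  eff := by decide +kernel
  eff4 := by decide +kernel
  rk := by decide +kernel
  rk4 := by decide +kernel

lemma counts : ∀ b < 4, ∀ r < 4,
      (Finset.univ.filter fun j => (M1 b r).testBit (code1 j) = true).card =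
      (Finset.univ.filter fun j => (M2 b r).testBit (code2 j) = true).card := by
  decide +kernel

lemma card_eq : Nat.card (ZMod 5 × ZMod 25) = Nat.card (ZMod 125) := by
  simp

lemma not_iso (e : (ZMod 5 × ZMod 25) ≃+ ZMod 125) : False := by
  have h1 : ∀ x : ZMod 5 × ZMod 25, 25 • x = 0 := by decide +kernel
  have h2 : (25 : ℕ) • (1 : ZMod 125) = 0 := by
    rw [← e.apply_symm_apply 1, ← map_nsmul, h1, map_zero]
  revert h2
  decide +kernel

lemma degSum8 (D : Fin 8 → ℤ) :
    degSum D = D 0 + D 1 + D 2 + D 3 + D 4 + D 5 + D 6 + D 7 := by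
  rw [degSum, Fin.sum_univ_eight]

/-- Adjacency as a decidable matrix. -/
def adjB (es : List (Fin 8 × Fin 8)) (v w : Fin 8) : Bool :=
  decide (v ≠ w) && (es.contains (v, w) || es.contains (w, v))

lemma mkG_adj (es : List (Fin 8 × Fin 8)) (v w : Fin 8) :
    (mkG es).Adj v w ↔ adjB es v w = true := by
  simp only [mkG, toE, SimpleGraph.fromEdgeSet_adj, adjB, Set.mem_ofPred_eq, List.mem_map,
    Sym2.eq_iff, Bool.and_eq_true, decide_eq_true_eq, Bool.or_eq_true, List.contains_iff_mem]
  constructor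
  · rintro ⟨⟨⟨a, b⟩, h1, ⟨rfl, rfl⟩ | ⟨rfl, rfl⟩⟩, h2⟩
    · exact ⟨h2, Or.inl h1⟩
    · exact ⟨h2, Or.inr h1⟩
  · rintro ⟨h2, h1 | h1⟩
    · exact ⟨⟨_, h1, Or.inl ⟨rfl, rfl⟩⟩, h2⟩
    · exact ⟨⟨_, h1, Or.inr ⟨rfl, rfl⟩⟩, h2⟩

lemma lap_mk (es : List (Fin 8 × Fin 8)) (f : Fin 8 → ℤ) (v : Fin 8) :
    lap (mkG es) f v = ∑ w, (if adjB es v w = true then f v - f w else 0) := by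
  rw [lap_eq]
  refine Finset.sum_congr rfl fun w _ => ?_
  simp only [mkG_adj]

/-- The Laplacian of the first graph, explicitly. -/
lemma lap1 (f : Fin 8 → ℤ) : lap (mkG es1) f =
    ![3 * f 0 - f 3 - f 4 - f 5, 2 * f 1 - f 3 - f 7, 2 * f 2 - f 4 - f 5,
      4 * f 3 - f 0 - f 1 - f 4 - f 6, 4 * f 4 - f 0 - f 2 - f 3 - f 7,
      3 * f 5 - f 0 - f 2 - f 6, 2 * f 6 - f 3 - f 5, 2 * f 7 - f 1 - f 4] := by
  funext v
  rw [lap_mk, Fin.sum_univ_eight]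
  fin_cases v <;> simp [adjB, es1] <;> ring

/-- The Laplacian of the second graph, explicitly. -/
lemma lap2 (f : Fin 8 → ℤ) : lap (mkG es2) f =
    ![4 * f 0 - f 1 - f 3 - f 6 - f 7, 3 * f 1 - f 0 - f 4 - f 5, 2 * f 2 - f 4 - f 6,
      4 * f 3 - f 0 - f 4 - f 5 - f 7, 3 * f 4 - f 1 - f 2 - f 3,
      2 * f 5 - f 1 - f 3, 2 * f 6 - f 0 - f 2, 2 * f 7 - f 0 - f 3] := by
  funext v
  rw [lap_mk, Fin.sum_univ_eight]
  fin_cases v <;> simp [adjB, es2] <;> ring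

lemma phi1_zero (D : Fin 8 → ℤ) : phi p1 D = 0 ↔
    (5 : ℤ) ∣ 4 * D 0 + D 2 + 2 * D 5 + D 6 ∧
    (25 : ℤ) ∣ 22 * D 0 + 24 * D 1 + 9 * D 2 + 23 * D 3 + D 4 + 17 * D 5 + 20 * D 6 := by
  have h1 : phi p1 D = (((4 * D 0 + D 2 + 2 * D 5 + D 6 : ℤ) : ZMod 5),
      ((22 * D 0 + 24 * D 1 + 9 * D 2 + 23 * D 3 + D 4 + 17 * D 5 + 20 * D 6 : ℤ) : ZMod 25)) := by
    rw [phi_apply, Fin.sum_univ_eight]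
    simp [p1]
    constructor <;> ring
  rw [h1, Prod.mk_eq_zero, ZMod.intCast_zmod_eq_zero_iff_dvd, ZMod.intCast_zmod_eq_zero_iff_dvd]
  rfl

lemma phi2_zero (D : Fin 8 → ℤ) : phi p2 D = 0 ↔
    (125 : ℤ) ∣ 17 * D 0 + 19 * D 1 + 115 * D 2 + 108 * D 3 + 39 * D 4 + D 5 + 66 * D 6 := by
  have h1 : phi p2 D = ((17 * D 0 + 19 * D 1 + 115 * D 2 + 108 * D 3 + 39 * D 4 + D 5
      + 66 * D 6 : ℤ) : ZMod 125) := by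
    rw [phi_apply, Fin.sum_univ_eight]
    simp [p2]
    ring
  rw [h1, ZMod.intCast_zmod_eq_zero_iff_dvd]
  rfl

lemma pic1 : PicData (mkG es1) p1 where
  ker D := by
    rw [phi1_zero, degSum8]
    constructor
    · rintro ⟨f, rfl⟩
      rw [lap1]
      simp only [Matrix.cons_val]
      refine ⟨by ring, ?_, ?_⟩ <;> omega
    · rintro ⟨h0, ⟨m0, h1⟩, ⟨m1, h2⟩⟩
      refine ⟨![(2) * D 0 + (1) * D 1 + (1) * D 3 + (1) * D 5 + (1) * D 6 + (-1) * m0 + (-1) * m1,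
        (18) * D 0 + (10) * D 1 + (5) * D 2 + (9) * D 3 + (11) * D 5 + (10) * D 6 + (-12) * m0
          + (-10) * m1,
        0,
        (5) * D 0 + (3) * D 1 + (1) * D 2 + (3) * D 3 + (3) * D 5 + (3) * D 6 + (-3) * m0
          + (-3) * m1,
        (-1) * D 0 + (-1) * D 1 + (-1) * D 2 + (-1) * D 3 + (-1) * D 5 + (-1) * D 6 + (1) * m1,
        (1) * D 0 + (1) * D 1 + (1) * D 3 + (1) * D 5 + (1) * D 6 + (-1) * m1,
        (1) * D 0 + (2) * D 1 + (2) * D 3 + (1) * D 5 + (2) * D 6 + (1) * m0 + (-2) * m1,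
        (31) * D 0 + (16) * D 1 + (9) * D 2 + (15) * D 3 + (19) * D 5 + (17) * D 6 + (-21) * m0
          + (-17) * m1], ?_⟩
      rw [lap1]
      funext v
      fin_cases v <;> simp only [Matrix.cons_val, Fin.reduceFinMk, Fin.zero_eta, Fin.mk_one,
        Fin.isValue] <;> omega
  surj j := by
    obtain ⟨a, b⟩ := j
    refine ⟨![0, 0, a.val, 0, b.val - 9 * a.val, 0, 0, 8 * a.val - b.val], ?_, ?_⟩
    · rw [degSum8]; simp only [Matrix.cons_val]; ring
    · rw [phi_apply, Fin.sum_univ_eight]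
      simp [p1]
      ring

lemma pic2 : PicData (mkG es2) p2 where
  ker D := by
    rw [phi2_zero, degSum8]
    constructor
    · rintro ⟨f, rfl⟩
      rw [lap2]
      simp only [Matrix.cons_val]
      refine ⟨by ring, ?_⟩
      omega
    · rintro ⟨h0, m0, h1⟩
      refine ⟨![(2) * D 0 + (2) * D 1 + (12) * D 2 + (11) * D 3 + (4) * D 4 + (7) * D 6
          + (-13) * m0,
        (-3) * D 0 + (-3) * D 1 + (-21) * D 2 + (-20) * D 3 + (-7) * D 4 + (-12) * D 6
          + (23) * m0,
        (-1) * D 3 + (1) * m0,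
        0,
        (-1) * D 0 + (-1) * D 1 + (-7) * D 2 + (-7) * D 3 + (-2) * D 4 + (-4) * D 6 + (8) * m0,
        (-10) * D 0 + (-11) * D 1 + (-68) * D 2 + (-64) * D 3 + (-23) * D 4 + (-39) * D 6
          + (74) * m0,
        (1) * D 0 + (1) * D 1 + (6) * D 2 + (5) * D 3 + (2) * D 4 + (4) * D 6 + (-6) * m0,
        (9) * D 0 + (10) * D 1 + (63) * D 2 + (59) * D 3 + (21) * D 4 + (36) * D 6
          + (-69) * m0], ?_⟩
      rw [lap2]
      funext v
      fin_cases v <;> simp only [Matrix.cons_val, Fin.reduceFinMk, Fin.zero_eta, Fin.mk_one,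
        Fin.isValue] <;> omega
  surj j := by
    refine ⟨![0, 0, 0, 0, 0, j.val, 0, - j.val], ?_, ?_⟩
    · rw [degSum8]; simp only [Matrix.cons_val]; ring
    · rw [phi_apply, Fin.sum_univ_eight]
      simp [p2]

end Concrete

/-- There are connected simple graphs on 8 vertices with 11 edges (hence of genus 4)
with equal Tutte polynomials and the same two-variable zeta function, whose Jacobians
are `ℤ/5ℤ × ℤ/25ℤ` and `ℤ/125ℤ` respectively; in particular the Jacobians are not
isomorphic. -/
theorem exists_genus4_sameTutte_sameZeta_nonIsoJac :
    ∃ G G' : SimpleGraph (Fin 8),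
      G.Connected ∧ G'.Connected ∧
      edgeCount G = 11 ∧ edgeCount G' = 11 ∧
      tutte G = tutte G' ∧
      SameZeta G G' ∧
      Nonempty (Jac G ≃+ (ZMod 5 × ZMod 25)) ∧
      Nonempty (Jac G' ≃+ ZMod 125) ∧
      ¬ Nonempty (Jac G ≃+ Jac G') := by
  refine ⟨mkG es1, mkG es2, conn1, conn2, mkG_edgeCount es1 diag1 nodup1,
    mkG_edgeCount es2 diag2 nodup2, ?_, ?_, pic1.jac, pic2.jac, ?_⟩
  · rw [tutte_eq es1 diag1 nodup1 (by decide) conn1, tutte_eq es2 diag2 nodup2 (by decide) conn2,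
      tables_eq]
  · exact sameZeta_of pic1 pic2 card_eq (mask_count mask1 mask2 card_eq counts)
  · rintro ⟨e⟩
    obtain ⟨e1⟩ := pic1.jac
    obtain ⟨e2⟩ := pic2.jac
    exact not_iso ((e1.symm.trans e).trans e2)

end BNGraph
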